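/- Let Σ be a σ-algebra on Ω, ℙ an atomless probability measure on Σ, D a nonempty ℙ-invariant subset of the space B(Σ) of bounded Σ-measurable random variables, φ : D → ℝ a ℙ-invariant functional, and let c ∈ ℝ be a constant with the constant random variable c belonging to D. Define L_c = {μ ∈ ca : (∀ X ∈ D, ∫ X dμ ≤ φ(X)) and c·μ(Ω) = φ(c)} and U_c = {μ ∈ ca : (∀ X ∈ D, ∫ X dμ ≥ φ(X)) and c·μ(Ω) = φ(c)}. If sup L_c exists in ca (setwise order), then sup L_c = a·ℙ for some constant a ∈ ℝ; likewise, if inf U_c exists in ca, then inf U_c = b·ℙ for some constant b ∈ ℝ. -/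

import Mathlib

open MeasureTheory

/-- The integral of a bounded random variable with respect to a finite signed measure,
via the Jordan decomposition. -/
noncomputable def signedIntegral {Ω : Type*} [MeasurableSpace Ω]
    (μ : SignedMeasure Ω) (X : Ω → ℝ) : ℝ :=
  (∫ ω, X ω ∂μ.toJordanDecomposition.posPart) - ∫ ω, X ω ∂μ.toJordanDecomposition.negPart

/-- Every measurable set of positive measure has a measurable subset of strictly smaller
positive measure. -/
def HasSmallerParts {Ω : Type*} [MeasurableSpace Ω] (P : Measure Ω) : Prop :=
  ∀ A : Set Ω, MeasurableSet A → 0 < P A →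
    ∃ B : Set Ω, MeasurableSet B ∧ B ⊆ A ∧ 0 < P B ∧ P B < P A

/-- Almost sure inclusion of measurable sets. -/
def AEIncl {Ω : Type*} [MeasurableSpace Ω] (P : Measure Ω)
    (S T : {S : Set Ω // MeasurableSet S}) : Prop :=
  (S : Set Ω) ≤ᵐ[P] (T : Set Ω)

theorem AEIncl.of_measure_le {Ω : Type*} [MeasurableSpace Ω] {P : Measure Ω} [IsFiniteMeasure P]
    {S T : {S : Set Ω // MeasurableSet S}} (h : AEIncl P S T ∨ AEIncl P T S)
    (hle : P S ≤ P T) : AEIncl P S T := by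
  rcases h with h | h
  · exact h
  · exact (ae_eq_of_ae_subset_of_measure_ge h hle T.2.nullMeasurableSet
      (measure_ne_top _ _)).symm.le

/-- A chain for almost sure inclusion that contains every measurable set comparable to all of its
members has a member of largest measure among those of measure at most `t`. -/
theorem exists_measure_le_of_chain {Ω : Type*} [MeasurableSpace Ω] {P : Measure Ω}
    [IsFiniteMeasure P] {C : Set {S : Set Ω // MeasurableSet S}}
    (hcomp : ∀ S ∈ C, ∀ T ∈ C, AEIncl P S T ∨ AEIncl P T S)
    (hmax : ∀ S, (∀ T ∈ C, AEIncl P S T ∨ AEIncl P T S) → S ∈ C) (t : ENNReal) :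
    ∃ S ∈ C, P S ≤ t ∧ ∀ T ∈ C, P T ≤ t → P T ≤ P S := by
  have hempty : (⟨∅, MeasurableSet.empty⟩ : {S : Set Ω // MeasurableSet S}) ∈ C :=
    hmax _ fun T _ => Or.inl (LE.le.eventuallyLE (Set.empty_subset _))
  obtain ⟨u, hu, hlim, hmem⟩ := exists_seq_tendsto_sSup
    (S := {x : ENNReal | ∃ S ∈ C, P S = x ∧ x ≤ t}) ⟨0, _, hempty, by simp, by simp⟩
    (OrderTop.bddAbove _)
  choose R hRC hRu hRt using hmem
  have hR : ∀ k n, k ≤ n → AEIncl P (R k) (R n) := fun k n hkn =>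
    AEIncl.of_measure_le (hcomp _ (hRC k) _ (hRC n)) (by rw [hRu, hRu]; exact hu hkn)
  refine ⟨⟨⋃ n, (R n : Set Ω), MeasurableSet.iUnion fun n => (R n).2⟩, hmax _ ?_, ?_, ?_⟩
  · intro T hT
    by_cases h : ∀ n, AEIncl P (R n) T
    · left
      have := Filter.EventuallyLE.countable_iUnion (l := ae P) h
      exact this.trans (LE.le.eventuallyLE (Set.iUnion_subset fun _ => subset_rfl))
    · right
      push Not at h
      obtain ⟨n, hn⟩ := h
      have := (hcomp _ (hRC n) _ hT).resolve_left hn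
      exact this.trans (LE.le.eventuallyLE (Set.subset_iUnion (fun n => (R n : Set Ω)) n))
  · change P (⋃ n, (R n : Set Ω)) ≤ t
    rw [measure_iUnion_eq_iSup_accumulate]
    refine iSup_le fun n => le_trans ?_ ((hRu n).trans_le (hRt n))
    refine measure_mono_ae ?_
    have : ∀ k : Set.Iic n, (R k : Set Ω) ≤ᵐ[P] (R n : Set Ω) := fun k => hR k n k.2
    have h2 := Filter.EventuallyLE.countable_iUnion (l := ae P) this
    refine Filter.EventuallyLE.trans (LE.le.eventuallyLE ?_)
      (h2.trans (LE.le.eventuallyLE (Set.iUnion_subset fun _ => subset_rfl)))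
    intro x hx
    obtain ⟨k, hk, hx⟩ := Set.mem_accumulate.1 hx
    exact Set.mem_iUnion.2 ⟨⟨k, hk⟩, hx⟩
  · intro T hT hTt
    have h1 : P T ≤ sSup {x : ENNReal | ∃ S ∈ C, P S = x ∧ x ≤ t} := le_sSup ⟨T, hT, rfl, hTt⟩
    refine h1.trans (le_of_tendsto' hlim fun n => ?_)
    rw [← hRu n]
    exact measure_mono (Set.subset_iUnion (fun n => (R n : Set Ω)) n)

/-- An atomless probability measure admits a family of measurable sets `S t` of measure `t`,
increasing up to null sets. -/
theorem exists_ae_monotone_family {Ω : Type*} [MeasurableSpace Ω] {P : Measure Ω}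
    [IsProbabilityMeasure P] (hP : HasSmallerParts P) :
    ∃ S : ℝ → Set Ω, (∀ t, MeasurableSet (S t)) ∧
      (∀ t ∈ Set.Icc (0 : ℝ) 1, P (S t) = ENNReal.ofReal t) ∧
      ∀ s ∈ Set.Icc (0 : ℝ) 1, ∀ t ∈ Set.Icc (0 : ℝ) 1, s ≤ t → S s ≤ᵐ[P] S t := by
  obtain ⟨C, hC⟩ : ∃ C, IsMaxChain (AEIncl P) C := ⟨_, maxChain_spec⟩
  have hcomp : ∀ S ∈ C, ∀ T ∈ C, AEIncl P S T ∨ AEIncl P T S := by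
    intro S hS T hT
    by_cases h : S = T
    · subst h
      exact Or.inl (Filter.EventuallyLE.refl _ _)
    · exact hC.1 hS hT h
  have hmax : ∀ S, (∀ T ∈ C, AEIncl P S T ∨ AEIncl P T S) → S ∈ C := by
    intro S hS
    rw [hC.2 (hC.1.insert fun T hT _ => hS T hT) (Set.subset_insert S C)]
    exact Set.mem_insert _ _
  have hattain : ∀ t : ENNReal, t ≤ 1 → ∃ S ∈ C, P S = t := by
    intro t ht
    obtain ⟨L, hL, hLt, hLmax⟩ := exists_measure_le_of_chain hcomp hmax t
    let co : {S : Set Ω // MeasurableSet S} → {S : Set Ω // MeasurableSet S} :=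
      fun S => ⟨(S : Set Ω)ᶜ, S.2.compl⟩
    have hco : ∀ S, co (co S) = S := fun S => Subtype.ext (compl_compl _)
    have hcole : ∀ S T, AEIncl P S T → AEIncl P (co T) (co S) := fun S T h =>
      Filter.EventuallyLE.compl h
    have hcoP : ∀ S, P (co S) = 1 - P S := fun S => prob_compl_eq_one_sub S.2
    obtain ⟨U, hU, hUt, hUmax⟩ := exists_measure_le_of_chain (P := P) (C := co ⁻¹' C)
      (fun S hS T hT => (hcomp _ hS _ hT).symm.imp
        (fun h => by simpa only [hco] using hcole _ _ h)
        (fun h => by simpa only [hco] using hcole _ _ h))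
      (fun S hS => hmax _ fun T hT => ((hS (co T) (by simpa [hco] using hT)).symm.imp
        (fun h => by simpa only [hco] using hcole _ _ h)
        (fun h => by simpa only [hco] using hcole _ _ h))) (1 - t)
    obtain ⟨V, rfl⟩ : ∃ V, U = co V := ⟨co U, (hco U).symm⟩
    rw [Set.mem_preimage, hco] at hU
    have hVt : t ≤ P V := by
      rw [hcoP] at hUt
      exact (ENNReal.sub_le_sub_iff_left ht ENNReal.one_ne_top).1 hUt
    have hVmin : ∀ T ∈ C, t ≤ P T → P V ≤ P T := by
      intro T hT hle
      have := hUmax (co T) (by simpa [hco] using hT) (by rw [hcoP]; gcongr)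
      rw [hcoP, hcoP] at this
      exact (ENNReal.sub_le_sub_iff_left prob_le_one ENNReal.one_ne_top).1 this
    rcases hLt.eq_or_lt with h | hlt
    · exact ⟨L, hL, h⟩
    have hLV : AEIncl P L V := AEIncl.of_measure_le (hcomp _ hL _ hU) (hLt.trans hVt)
    have hsplit : P V = P L + P ((V : Set Ω) \ L) := by
      rw [← measure_inter_add_sdiff (V : Set Ω) L.2]
      congr 1
      refine measure_congr ?_
      filter_upwards [hLV] with x hx
      exact propext ⟨fun h => h.2, fun h => ⟨hx h, h⟩⟩
    have hpos : 0 < P ((V : Set Ω) \ L) := by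
      rw [pos_iff_ne_zero]
      intro h0
      rw [h0, add_zero] at hsplit
      exact absurd (hVt.trans hsplit.le) (not_le.2 hlt)
    obtain ⟨B, hB, hBsub, hB0, hBlt⟩ := hP _ (V.2.diff L.2) hpos
    let T : {S : Set Ω // MeasurableSet S} := ⟨L ∪ B, L.2.union hB⟩
    have hPT : P T = P L + P B :=
      measure_union (Set.disjoint_left.2 fun x hx hxB => (hBsub hxB).2 hx) hB
    have hTV : AEIncl P T V := by
      filter_upwards [hLV] with x hx hxT
      exact hxT.elim (fun h => hx h) fun h => (hBsub h).1
    have hT : T ∈ C := by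
      refine hmax _ fun R hR => ?_
      rcases le_total (P R) t with h | h
      · right
        exact (AEIncl.of_measure_le (hcomp _ hR _ hL) (hLmax R hR h)).trans
          (LE.le.eventuallyLE Set.subset_union_left)
      · left
        exact hTV.trans (AEIncl.of_measure_le (hcomp _ hU _ hR) (hVmin R hR h))
    have hLT : P L < P T := by
      rw [hPT]
      exact ENNReal.lt_add_right (measure_ne_top _ _) hB0.ne'
    have hTt : t ≤ P T := by
      by_contra! h
      exact absurd (hLmax T hT h.le) (not_le.2 hLT)
    have := hVmin T hT hTt
    rw [hsplit, hPT] at this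
    exact absurd this (not_le.2 (ENNReal.add_lt_add_left (measure_ne_top _ _) hBlt))
  have : ∀ t : ℝ, ∃ S ∈ C, t ∈ Set.Icc (0 : ℝ) 1 → P S = ENNReal.ofReal t := by
    intro t
    by_cases ht : t ∈ Set.Icc (0 : ℝ) 1
    · obtain ⟨S, hS, h⟩ := hattain (ENNReal.ofReal t) (by simpa using ht.2)
      exact ⟨S, hS, fun _ => h⟩
    · obtain ⟨S, hS, h⟩ := hattain 0 (by simp)
      exact ⟨S, hS, fun h => absurd h ht⟩
  choose S hSC hSt using this
  refine ⟨fun t => S t, fun t => (S t).2, hSt, fun s hs t ht hst => ?_⟩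
  exact AEIncl.of_measure_le (hcomp _ (hSC s) _ (hSC t))
    (by rw [hSt s hs, hSt t ht]; exact ENNReal.ofReal_le_ofReal hst)

/-- An atomless probability space carries a random variable that is uniform on `(0, 1]`. -/
theorem exists_map_eq_uniform {Ω : Type*} [MeasurableSpace Ω] {P : Measure Ω}
    [IsProbabilityMeasure P] (hP : HasSmallerParts P) :
    ∃ U : Ω → ℝ, Measurable U ∧ P.map U = volume.restrict (Set.Ioc 0 1) := by
  classical
  obtain ⟨S, hSm, hSt, hSle⟩ := exists_ae_monotone_family hP
  let ι := {q : ℚ // (q : ℝ) ∈ Set.Icc (0 : ℝ) 1}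
  have : Nonempty ι := ⟨⟨0, by simp⟩⟩
  let f : ι → Ω → ℝ := fun q => (S (q : ℚ)).piecewise (fun _ => ((q : ℚ) : ℝ)) (fun _ => 1)
  have hf : ∀ q, Measurable (f q) := fun q =>
    Measurable.piecewise (hSm _) measurable_const measurable_const
  have hf0 : ∀ q x, 0 ≤ f q x := by
    intro q x
    by_cases h : x ∈ S (q : ℚ)
    · simpa [f, h] using q.2.1
    · simp [f, h]
  have hbdd : ∀ x, BddBelow (Set.range fun q => f q x) := fun x =>
    ⟨0, by rintro _ ⟨q, rfl⟩; exact hf0 q x⟩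
  have hU : Measurable fun x => ⨅ q, f q x := Measurable.iInf hf
  have hf1 : ∀ x, ⨅ q, f q x ≤ 1 := by
    intro x
    refine (ciInf_le (hbdd x) ⟨1, by simp⟩).trans ?_
    by_cases h : x ∈ S 1 <;> simp [f, h]
  have hprob : IsProbabilityMeasure (volume.restrict (Set.Ioc (0 : ℝ) 1)) := ⟨by simp⟩
  have hprob' : IsProbabilityMeasure (P.map fun x => ⨅ q, f q x) :=
    Measure.isProbabilityMeasure_map hU.aemeasurable
  refine ⟨fun x => ⨅ q, f q x, hU, ?_⟩
  refine Measure.ext_of_Ici _ _ fun r => ?_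
  have key : P.map (fun x => ⨅ q, f q x) (Set.Iio r) =
      volume.restrict (Set.Ioc (0 : ℝ) 1) (Set.Iio r) := by
    rw [Measure.map_apply hU measurableSet_Iio, Measure.restrict_apply measurableSet_Iio]
    rcases le_or_gt r 0 with hr | hr
    · have h1 : (fun x => ⨅ q, f q x) ⁻¹' Set.Iio r = ∅ := by
        ext x
        simpa using hr.trans (Real.iInf_nonneg fun q => hf0 q x)
      have h2 : Set.Iio r ∩ Set.Ioc (0 : ℝ) 1 = ∅ := by
        ext x
        simp only [Set.mem_inter_iff, Set.mem_Iio, Set.mem_Ioc, Set.mem_empty_iff_false, iff_false]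
        intro h
        linarith [h.1, h.2.1]
      rw [h1, h2, measure_empty, measure_empty]
    rcases lt_or_ge 1 r with hr1 | hr1
    · have h1 : (fun x => ⨅ q, f q x) ⁻¹' Set.Iio r = Set.univ := by
        ext x
        simpa using (hf1 x).trans_lt hr1
      have h2 : Set.Iio r ∩ Set.Ioc (0 : ℝ) 1 = Set.Ioc 0 1 := by
        refine Set.inter_eq_right.2 fun x hx => hx.2.trans_lt hr1
      rw [h1, h2]
      simp
    have h2 : Set.Iio r ∩ Set.Ioc (0 : ℝ) 1 = Set.Ioo 0 r := by
      ext x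
      simp only [Set.mem_inter_iff, Set.mem_Iio, Set.mem_Ioc, Set.mem_Ioo]
      constructor
      · exact fun h => ⟨h.2.1, h.1⟩
      · exact fun h => ⟨h.2, h.1, (h.2.trans_le hr1).le⟩
    rw [h2, Real.volume_Ioo, sub_zero]
    have hmem : ∀ x, ⨅ q, f q x < r ↔ ∃ q : ι, ((q : ℚ) : ℝ) < r ∧ x ∈ S (q : ℚ) := by
      intro x
      constructor
      · intro h
        obtain ⟨q, hq⟩ := exists_lt_of_ciInf_lt h
        by_cases hx : x ∈ S (q : ℚ)
        · exact ⟨q, by simpa [f, hx] using hq, hx⟩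
        · have : 1 < r := by simpa [f, hx] using hq
          linarith
      · rintro ⟨q, hq, hx⟩
        refine (ciInf_le (hbdd x) q).trans_lt ?_
        simpa [f, hx] using hq
    have hrI : r ∈ Set.Icc (0 : ℝ) 1 := ⟨hr.le, hr1⟩
    refine le_antisymm ?_ ?_
    · rw [← hSt r hrI]
      refine measure_mono_ae ?_
      have : ∀ᵐ x ∂P, ∀ q : ι, ((q : ℚ) : ℝ) < r → x ∈ S (q : ℚ) → x ∈ S r := by
        rw [ae_all_iff]
        intro q
        by_cases hq : ((q : ℚ) : ℝ) < r
        · filter_upwards [hSle _ q.2 _ hrI hq.le] with x hx _ h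
          exact hx h
        · exact Filter.Eventually.of_forall fun x h => absurd h hq
      filter_upwards [this] with x hx h
      obtain ⟨q, hq, hxq⟩ := (hmem x).1 h
      exact hx q hq hxq
    · refine le_of_forall_lt fun y hy => ?_
      have hytop : y ≠ ⊤ := (hy.trans ENNReal.ofReal_lt_top).ne
      have hy' : y.toReal < r := (ENNReal.lt_ofReal_iff_toReal_lt hytop).1 hy
      obtain ⟨q, hq1, hq2⟩ := exists_rat_btwn hy'
      have hq0 : (0 : ℝ) ≤ q := ENNReal.toReal_nonneg.trans hq1.le
      let q' : ι := ⟨q, hq0, hq2.le.trans hr1⟩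
      calc y < ENNReal.ofReal q := (ENNReal.lt_ofReal_iff_toReal_lt hytop).2 hq1
        _ = P (S q) := (hSt _ q'.2).symm
        _ ≤ _ := measure_mono fun x hx => (hmem x).2 ⟨q', hq2, hx⟩
  rw [← Set.compl_Iio, prob_compl_eq_one_sub measurableSet_Iio,
    prob_compl_eq_one_sub measurableSet_Iio, key]

/-- Every probability law on the line is the law of a measurable function on the circle. -/
theorem exists_map_addCircle_eq (ν : Measure ℝ) [IsProbabilityMeasure ν] :
    ∃ q : UnitAddCircle → ℝ, Measurable q ∧ (volume : Measure UnitAddCircle).map q = ν := by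
  obtain ⟨f, hf, hfν⟩ := ν.exists_measurable_map_eq
  let g : UnitAddCircle → ℝ := fun x => AddCircle.measurableEquivIoc 1 0 x
  have hg : Measurable g :=
    measurable_subtype_coe.comp (AddCircle.measurableEquivIoc 1 0).measurable
  have hproj : Measurable (Set.projIcc (0 : ℝ) 1 zero_le_one) := continuous_projIcc.measurable
  have hgmap : (volume : Measure UnitAddCircle).map g = volume.restrict (Set.Ioc 0 1) := by
    have h1 := (AddCircle.measurePreserving_equivIoc (T := (1 : ℝ)) (a := 0))
    have h2 := measurePreserving_subtype_coe (μa := (volume : Measure ℝ))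
      (measurableSet_Ioc (a := (0 : ℝ)) (b := 0 + 1))
    exact (h2.comp h1).map_eq.trans (by rw [zero_add])
  have hI : (volume.restrict (Set.Ioc (0 : ℝ) 1)).map (Set.projIcc (0 : ℝ) 1 zero_le_one) =
      (volume : Measure unitInterval) := by
    rw [restrict_Ioc_eq_restrict_Icc, ← unitInterval.measurePreserving_coe.map_eq,
      Measure.map_map hproj measurable_subtype_coe]
    convert Measure.map_id
    ext x
    simp
  refine ⟨f ∘ Set.projIcc (0 : ℝ) 1 zero_le_one ∘ g, hf.comp (hproj.comp hg), ?_⟩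
  rw [← Measure.map_map hf (hproj.comp hg), ← Measure.map_map hproj hg, hgmap, hI, hfν]

/-- Conditioning an atomless measure keeps it atomless. -/
theorem HasSmallerParts.cond {Ω : Type*} [MeasurableSpace Ω] {P : Measure Ω} [IsFiniteMeasure P]
    (hP : HasSmallerParts P) {A : Set Ω} (hA : MeasurableSet A) (hA0 : P A ≠ 0) :
    HasSmallerParts (ProbabilityTheory.cond P A) := by
  intro S hS hpos
  have hinv : (P A)⁻¹ ≠ ⊤ := ENNReal.inv_ne_top.2 hA0
  have hinv0 : (P A)⁻¹ ≠ 0 := ENNReal.inv_ne_zero.2 (measure_ne_top _ _)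
  rw [ProbabilityTheory.cond_apply hA] at hpos
  obtain ⟨B, hB, hBsub, hB0, hBlt⟩ := hP (A ∩ S) (hA.inter hS) (ENNReal.mul_pos_iff.1 hpos).2
  have hAB : A ∩ B = B := Set.inter_eq_right.2 fun x hx => (hBsub hx).1
  refine ⟨B, hB, fun x hx => (hBsub hx).2, ?_, ?_⟩
  · rw [ProbabilityTheory.cond_apply hA, hAB]
    exact ENNReal.mul_pos hinv0 hB0.ne'
  · rw [ProbabilityTheory.cond_apply hA, ProbabilityTheory.cond_apply hA, hAB]
    exact ENNReal.mul_lt_mul_right hinv0 hinv hBlt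

/-- On every set of positive measure there is a variable that is conditionally uniform on the
circle. -/
theorem exists_cond_map_eq_volume {Ω : Type*} [MeasurableSpace Ω] {P : Measure Ω}
    [IsProbabilityMeasure P] (hP : HasSmallerParts P) {A : Set Ω} (hA : MeasurableSet A)
    (hA0 : P A ≠ 0) :
    ∃ U : Ω → UnitAddCircle, Measurable U ∧
      (ProbabilityTheory.cond P A).map U = (volume : Measure UnitAddCircle) := by
  have := ProbabilityTheory.cond_isProbabilityMeasure hA0
  obtain ⟨U, hU, hmap⟩ := exists_map_eq_uniform (hP.cond hA hA0)
  have h := UnitAddCircle.measurePreserving_mk 0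
  refine ⟨_, h.measurable.comp hU, ?_⟩
  rw [← Measure.map_map h.measurable hU, hmap, ← h.map_eq, zero_add]

/-- The conditional law of a bounded variable is the law of a measurable function on the circle
with the same bound. -/
theorem exists_bounded_map_addCircle_eq_cond {Ω : Type*} [MeasurableSpace Ω] {P : Measure Ω}
    [IsProbabilityMeasure P] {A : Set Ω} (hA0 : P A ≠ 0) {X : Ω → ℝ} (hX : Measurable X)
    {C : ℝ} (hC : ∀ ω, |X ω| ≤ C) :
    ∃ q : UnitAddCircle → ℝ, Measurable q ∧ (∀ x, |q x| ≤ C) ∧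
      (volume : Measure UnitAddCircle).map q = (ProbabilityTheory.cond P A).map X := by
  have := ProbabilityTheory.cond_isProbabilityMeasure hA0
  have := Measure.isProbabilityMeasure_map (μ := ProbabilityTheory.cond P A) hX.aemeasurable
  obtain ⟨q, hq, hmap⟩ := exists_map_addCircle_eq ((ProbabilityTheory.cond P A).map X)
  have hclip : Measurable fun x : ℝ => max (-C) (min x C) := by fun_prop
  refine ⟨(fun x : ℝ => max (-C) (min x C)) ∘ q, hclip.comp hq, fun x => ?_, ?_⟩
  · have : 0 ≤ C := by
      obtain ⟨ω⟩ : Nonempty Ω := by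
        by_contra h
        rw [not_nonempty_iff] at h
        exact hA0 (by simp [Set.eq_empty_of_isEmpty A])
      exact (abs_nonneg _).trans (hC ω)
    rw [abs_le]
    exact ⟨le_max_left _ _, max_le (by linarith) (min_le_right _ _)⟩
  · rw [← Measure.map_map hclip hq, hmap, Measure.map_map hclip hX]
    congr 1
    ext ω
    have := abs_le.1 (hC ω)
    simp [this.1, this.2]

/-- In an atomless measure two sets of positive measure have measurable subsets of equal positive
measure. -/
theorem HasSmallerParts.exists_equal_parts {Ω : Type*} [MeasurableSpace Ω] {P : Measure Ω}
    [IsProbabilityMeasure P] (hP : HasSmallerParts P) {A B : Set Ω} (hA : MeasurableSet A)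
    (hB : MeasurableSet B) (hA0 : P A ≠ 0) (hB0 : P B ≠ 0) :
    ∃ A' ⊆ A, ∃ B' ⊆ B, MeasurableSet A' ∧ MeasurableSet B' ∧ P A' = P B' ∧ P A' ≠ 0 := by
  wlog h : P A ≤ P B generalizing A B
  · obtain ⟨B', hB', A', hA', h1, h2, h3, h4⟩ := this hB hA hB0 hA0 (le_of_not_ge h)
    exact ⟨A', hA', B', hB', h2, h1, h3.symm, h3 ▸ h4⟩
  have := ProbabilityTheory.cond_isProbabilityMeasure hB0
  obtain ⟨S, hSm, hSt, -⟩ := exists_ae_monotone_family (hP.cond hB hB0)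
  have hle : P A / P B ≤ 1 := ENNReal.div_le_of_le_mul (by simpa using h)
  have hne : P A / P B ≠ ⊤ := (hle.trans_lt ENNReal.one_lt_top).ne
  have := hSt (P A / P B).toReal
    ⟨ENNReal.toReal_nonneg, ENNReal.toReal_le_of_le_ofReal zero_le_one (by simpa using hle)⟩
  rw [ENNReal.ofReal_toReal hne] at this
  refine ⟨A, subset_rfl, B ∩ S (P A / P B).toReal, Set.inter_subset_left, hA, hB.inter (hSm _),
    ?_, hA0⟩
  rw [← ProbabilityTheory.cond_mul_eq_inter hB, this, ENNReal.div_mul_cancel hB0 (measure_ne_top _ _)]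

/-- Any bounded measurable function is integrable for a finite measure. -/
theorem integrable_of_abs_le {Ω : Type*} [MeasurableSpace Ω] (ν : Measure Ω) [IsFiniteMeasure ν]
    {X : Ω → ℝ} (hX : Measurable X) {C : ℝ} (hC : ∀ ω, |X ω| ≤ C) : Integrable X ν :=
  Integrable.of_bound hX.aestronglyMeasurable C (Filter.Eventually.of_forall hC)

theorem signedMeasure_apply_eq_posPart_sub_negPart {Ω : Type*} [MeasurableSpace Ω]
    (μ : SignedMeasure Ω) {A : Set Ω} (hA : MeasurableSet A) :
    μ A = μ.toJordanDecomposition.posPart.real A - μ.toJordanDecomposition.negPart.real A := by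
  conv_lhs => rw [← μ.toSignedMeasure_toJordanDecomposition]
  exact Measure.toSignedMeasure_sub_apply hA

/-- The integral against a difference of two finite measures does not depend on the chosen
decomposition. -/
theorem signedIntegral_toSignedMeasure_sub {Ω : Type*} [MeasurableSpace Ω] (ν₁ ν₂ : Measure Ω)
    [IsFiniteMeasure ν₁] [IsFiniteMeasure ν₂] {X : Ω → ℝ} (hX : Measurable X) {C : ℝ}
    (hC : ∀ ω, |X ω| ≤ C) :
    signedIntegral (ν₁.toSignedMeasure - ν₂.toSignedMeasure) X =
      ∫ ω, X ω ∂ν₁ - ∫ ω, X ω ∂ν₂ := by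
  set μ := ν₁.toSignedMeasure - ν₂.toSignedMeasure with hμ
  have key : μ.toJordanDecomposition.posPart + ν₂ = μ.toJordanDecomposition.negPart + ν₁ := by
    refine Measure.ext fun A hA => ?_
    rw [← measureReal_eq_measureReal_iff, measureReal_add_apply, measureReal_add_apply]
    have h1 := signedMeasure_apply_eq_posPart_sub_negPart μ hA
    rw [hμ, Measure.toSignedMeasure_sub_apply hA, ← hμ] at h1
    linarith
  have h := congrArg (fun ν : Measure Ω => ∫ ω, X ω ∂ν) key
  rw [integral_add_measure (integrable_of_abs_le _ hX hC) (integrable_of_abs_le _ hX hC),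
    integral_add_measure (integrable_of_abs_le _ hX hC) (integrable_of_abs_le _ hX hC)] at h
  unfold signedIntegral
  linarith

theorem signedIntegral_neg {Ω : Type*} [MeasurableSpace Ω] (μ : SignedMeasure Ω) (X : Ω → ℝ) :
    signedIntegral (-μ) X = -signedIntegral μ X := by
  simp [signedIntegral, SignedMeasure.toJordanDecomposition_neg]

theorem signedIntegral_add_indicator {Ω : Type*} [MeasurableSpace Ω] (μ : SignedMeasure Ω)
    {X : Ω → ℝ} (hX : Measurable X) {C : ℝ} (hC : ∀ ω, |X ω| ≤ C) {N : Set Ω}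
    (hN : MeasurableSet N) (t : ℝ) :
    signedIntegral μ (fun ω => X ω + N.indicator (fun _ => t) ω) =
      signedIntegral μ X + t * μ N := by
  unfold signedIntegral
  have hint : ∀ ν : Measure Ω, IsFiniteMeasure ν →
      ∫ ω, (X ω + N.indicator (fun _ => t) ω) ∂ν = ∫ ω, X ω ∂ν + ν.real N * t := by
    intro ν _
    rw [integral_add (integrable_of_abs_le _ hX hC) ((integrable_const t).indicator hN),
      integral_indicator hN, setIntegral_const, smul_eq_mul]
  rw [hint _ inferInstance, hint _ inferInstance,
    signedMeasure_apply_eq_posPart_sub_negPart μ hN]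
  ring

/-- Outside `A ∪ B` keep `ν`; put the mass of `A` on `B`, and that of `B` on `A`, spread
proportionally to `P`. -/
noncomputable def exchangeMass {Ω : Type*} [MeasurableSpace Ω] (P : Measure Ω) (A B : Set Ω)
    (ν : Measure Ω) : Measure Ω :=
  ν.restrict (A ∪ B)ᶜ + (ν A • ProbabilityTheory.cond P B + ν B • ProbabilityTheory.cond P A)

instance {Ω : Type*} [MeasurableSpace Ω] (P : Measure Ω) [IsFiniteMeasure P] (A B : Set Ω)
    (ν : Measure Ω) [IsFiniteMeasure ν] : IsFiniteMeasure (exchangeMass P A B ν) := by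
  have h1 := (ProbabilityTheory.cond P A).smul_finite (measure_ne_top ν B)
  have h2 := (ProbabilityTheory.cond P B).smul_finite (measure_ne_top ν A)
  unfold exchangeMass
  infer_instance

open Classical in
/-- The variable `X`, with its values on `A` and `B` replaced by functions of uniform variables
rotated by `θ`. -/
noncomputable def rotated {Ω : Type*} (A B : Set Ω) (U V : Ω → UnitAddCircle) (p q : UnitAddCircle → ℝ)
    (X : Ω → ℝ) (θ : UnitAddCircle) (ω : Ω) : ℝ :=
  if ω ∈ A then p (U ω + θ) else if ω ∈ B then q (V ω + θ) else X ω

theorem abs_rotated_le {Ω : Type*} {A B : Set Ω} {U V : Ω → UnitAddCircle}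
    {p q : UnitAddCircle → ℝ} {X : Ω → ℝ} {C : ℝ} (hp : ∀ x, |p x| ≤ C) (hq : ∀ x, |q x| ≤ C) (hC : ∀ ω, |X ω| ≤ C)
    (θ : UnitAddCircle) (ω : Ω) : |rotated A B U V p q X θ ω| ≤ C := by
  unfold rotated
  split_ifs
  exacts [hp _, hq _, hC _]

section Exchange

variable {Ω : Type*} [MeasurableSpace Ω] {P : Measure Ω} {A B : Set Ω}
  {U V : Ω → UnitAddCircle} {p q : UnitAddCircle → ℝ} {X : Ω → ℝ} {C : ℝ}

theorem exchangeMass_univ [IsFiniteMeasure P] (hA : MeasurableSet A) (hB : MeasurableSet B) (hAB : Disjoint A B)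
    (hA0 : P A ≠ 0) (hB0 : P B ≠ 0) (ν : Measure Ω) :
    exchangeMass P A B ν Set.univ = ν Set.univ := by
  have := ProbabilityTheory.cond_isProbabilityMeasure hA0
  have := ProbabilityTheory.cond_isProbabilityMeasure hB0
  conv_rhs => rw [← measure_add_measure_compl (hA.union hB), measure_union hAB hB, add_comm]
  simp [exchangeMass]

theorem exchangeMass_apply [IsFiniteMeasure P] (hA : MeasurableSet A) (hB : MeasurableSet B) (hAB : Disjoint A B)
    (hB0 : P B ≠ 0) (ν : Measure Ω) : exchangeMass P A B ν B = ν A := by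
  have h1 : B ∩ (Aᶜ ∩ Bᶜ) = ∅ := by
    ext x
    simp only [Set.mem_inter_iff, Set.mem_compl_iff, Set.mem_empty_iff_false]
    tauto
  simp [exchangeMass, Measure.restrict_apply hB, h1, ProbabilityTheory.cond_apply hA,
    ProbabilityTheory.cond_apply hB, hAB.inter_eq, ENNReal.inv_mul_cancel hB0 (measure_ne_top P B)]

theorem integral_exchangeMass (ν : Measure Ω) [IsFiniteMeasure ν]
    (hX : Measurable X) (hC : ∀ ω, |X ω| ≤ C) :
    ∫ ω, X ω ∂exchangeMass P A B ν = ∫ ω in (A ∪ B)ᶜ, X ω ∂ν +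
      (ν.real A * ∫ ω, X ω ∂ProbabilityTheory.cond P B +
        ν.real B * ∫ ω, X ω ∂ProbabilityTheory.cond P A) := by
  have h1 := (ProbabilityTheory.cond P A).smul_finite (measure_ne_top ν B)
  have h2 := (ProbabilityTheory.cond P B).smul_finite (measure_ne_top ν A)
  unfold exchangeMass
  rw [integral_add_measure (integrable_of_abs_le _ hX hC) (integrable_of_abs_le _ hX hC),
    integral_add_measure (integrable_of_abs_le _ hX hC) (integrable_of_abs_le _ hX hC),
    integral_smul_measure, integral_smul_measure]
  rfl


theorem measurable_uncurry_rotated (hA : MeasurableSet A) (hB : MeasurableSet B)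
    (hU : Measurable U) (hV : Measurable V) (hp : Measurable p) (hq : Measurable q)
    (hX : Measurable X) : Measurable (Function.uncurry (rotated A B U V p q X)) := by
  unfold rotated Function.uncurry
  refine Measurable.ite (measurable_snd hA) ?_ (Measurable.ite (measurable_snd hB) ?_ ?_)
  · fun_prop
  · fun_prop
  · fun_prop

theorem measure_inter_rotation [IsFiniteMeasure P] (hA : MeasurableSet A) (hB : MeasurableSet B) (hPAB : P A = P B)
    (hU : Measurable U) (hUP : (ProbabilityTheory.cond P A).map U = volume)
    (hp : Measurable p) (hX : Measurable X)
    (hpX : (volume : Measure UnitAddCircle).map p = (ProbabilityTheory.cond P B).map X)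
    (θ : UnitAddCircle) {E : Set ℝ} (hE : MeasurableSet E) :
    P (A ∩ {ω | p (U ω + θ) ∈ E}) = P (B ∩ X ⁻¹' E) := by
  have hpE : MeasurableSet ((fun u => u + θ) ⁻¹' (p ⁻¹' E)) := measurable_add_const θ (hp hE)
  rw [← ProbabilityTheory.cond_mul_eq_inter hA, ← ProbabilityTheory.cond_mul_eq_inter hB, hPAB]
  congr 1
  calc ProbabilityTheory.cond P A {ω | p (U ω + θ) ∈ E}
      = (ProbabilityTheory.cond P A).map U ((fun u => u + θ) ⁻¹' (p ⁻¹' E)) := by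
        rw [Measure.map_apply hU hpE]; rfl
    _ = (volume : Measure UnitAddCircle) (p ⁻¹' E) := by rw [hUP, measure_preimage_add_right]
    _ = _ := by rw [← Measure.map_apply hp hE, hpX, Measure.map_apply hX hE]

theorem measure_split (hA : MeasurableSet A) (hB : MeasurableSet B) (hAB : Disjoint A B)
    (S : Set Ω) : P S = P (A ∩ S) + P (B ∩ S) + P (S \ (A ∪ B)) := by
  have h : A ∩ (S ∩ (A ∪ B)) = A ∩ S ∧ (S ∩ (A ∪ B)) \ A = B ∩ S := by
    constructor <;> ext x <;>
      simp only [Set.mem_inter_iff, Set.mem_union, Set.mem_sdiff]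
    · tauto
    · have := fun h : x ∈ B => hAB.notMem_of_mem_right h
      tauto
  rw [← measure_inter_add_sdiff S (hA.union hB), ← measure_inter_add_sdiff (S ∩ (A ∪ B)) hA,
    Set.inter_comm _ A, h.1, h.2]

theorem map_rotated [IsFiniteMeasure P] (hA : MeasurableSet A) (hB : MeasurableSet B) (hAB : Disjoint A B)
    (hPAB : P A = P B) (hU : Measurable U) (hV : Measurable V)
    (hUP : (ProbabilityTheory.cond P A).map U = volume)
    (hVP : (ProbabilityTheory.cond P B).map V = volume)
    (hp : Measurable p) (hq : Measurable q) (hX : Measurable X)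
    (hpX : (volume : Measure UnitAddCircle).map p = (ProbabilityTheory.cond P B).map X)
    (hqX : (volume : Measure UnitAddCircle).map q = (ProbabilityTheory.cond P A).map X)
    (θ : UnitAddCircle) : P.map X = P.map (rotated A B U V p q X θ) := by
  have hY : Measurable (rotated A B U V p q X θ) :=
    (measurable_uncurry_rotated hA hB hU hV hp hq hX).of_uncurry_left
  refine Measure.ext fun E hE => ?_
  rw [Measure.map_apply hX hE, Measure.map_apply hY hE, measure_split hA hB hAB,
    measure_split hA hB hAB (rotated A B U V p q X θ ⁻¹' E)]
  have h1 : A ∩ rotated A B U V p q X θ ⁻¹' E = A ∩ {ω | p (U ω + θ) ∈ E} := by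
    ext ω
    simp +contextual [rotated]
  have h2 : B ∩ rotated A B U V p q X θ ⁻¹' E = B ∩ {ω | q (V ω + θ) ∈ E} := by
    ext ω
    have := fun h : ω ∈ B => hAB.notMem_of_mem_right h
    simp +contextual [rotated, this]
  have h3 : rotated A B U V p q X θ ⁻¹' E \ (A ∪ B) = X ⁻¹' E \ (A ∪ B) := by
    ext ω
    simp +contextual [rotated]
  rw [h1, h2, h3, measure_inter_rotation hA hB hPAB hU hUP hp hX hpX θ hE,
    measure_inter_rotation hB hA hPAB.symm hV hVP hq hX hqX θ hE, add_comm (P (A ∩ X ⁻¹' E))]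

theorem integral_rotation (hp : Measurable p) (hX : Measurable X)
    (hpX : (volume : Measure UnitAddCircle).map p = (ProbabilityTheory.cond P B).map X)
    (u : UnitAddCircle) :
    ∫ θ : UnitAddCircle, p (u + θ) = ∫ ω, X ω ∂ProbabilityTheory.cond P B := by
  rw [integral_add_left_eq_self p u]
  have h1 := integral_map (μ := (volume : Measure UnitAddCircle)) hp.aemeasurable
    (f := id) aestronglyMeasurable_id
  have h2 := integral_map (μ := ProbabilityTheory.cond P B) hX.aemeasurable
    (f := id) aestronglyMeasurable_id
  simp only [id] at h1 h2
  rw [← h1, hpX, h2]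

/-- Averaging the rotated variables over all rotations amounts to exchanging mass. -/
theorem integral_integral_rotated (hA : MeasurableSet A) (hB : MeasurableSet B)
    (hAB : Disjoint A B) (hU : Measurable U) (hV : Measurable V)
    (hp : Measurable p) (hq : Measurable q) (hX : Measurable X)
    (hpC : ∀ x, |p x| ≤ C) (hqC : ∀ x, |q x| ≤ C) (hC : ∀ ω, |X ω| ≤ C)
    (hpX : (volume : Measure UnitAddCircle).map p = (ProbabilityTheory.cond P B).map X)
    (hqX : (volume : Measure UnitAddCircle).map q = (ProbabilityTheory.cond P A).map X)
    (ν : Measure Ω) [IsFiniteMeasure ν] :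
    ∫ θ : UnitAddCircle, ∫ ω, rotated A B U V p q X θ ω ∂ν =
      ∫ ω, X ω ∂exchangeMass P A B ν := by
  have hint := integrable_of_abs_le ((volume : Measure UnitAddCircle).prod ν)
    (measurable_uncurry_rotated (A := A) (B := B) hA hB hU hV hp hq hX)
    (fun x => abs_rotated_le hpC hqC hC x.1 x.2)
  have hint2 : Integrable (fun ω => ∫ θ : UnitAddCircle, rotated A B U V p q X θ ω) ν :=
    hint.integral_prod_right
  rw [integral_integral_swap hint, ← integral_add_compl (hA.union hB) hint2,
    setIntegral_union hAB hB hint2.integrableOn hint2.integrableOn,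
    integral_exchangeMass ν hX hC]
  have h1 : ∫ ω in A, (∫ θ : UnitAddCircle, rotated A B U V p q X θ ω) ∂ν =
      ν.real A * ∫ ω, X ω ∂ProbabilityTheory.cond P B := by
    rw [setIntegral_congr_fun (g := fun _ => ∫ ω, X ω ∂ProbabilityTheory.cond P B) hA,
      setIntegral_const, smul_eq_mul]
    intro ω hω
    simp only [rotated, hω, if_true]
    exact integral_rotation hp hX hpX _
  have h2 : ∫ ω in B, (∫ θ : UnitAddCircle, rotated A B U V p q X θ ω) ∂ν =
      ν.real B * ∫ ω, X ω ∂ProbabilityTheory.cond P A := by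
    rw [setIntegral_congr_fun (g := fun _ => ∫ ω, X ω ∂ProbabilityTheory.cond P A) hB,
      setIntegral_const, smul_eq_mul]
    intro ω hω
    simp only [rotated, hω, hAB.notMem_of_mem_right hω, if_true, if_false]
    exact integral_rotation hq hX hqX _
  have h3 : ∫ ω in (A ∪ B)ᶜ, (∫ θ : UnitAddCircle, rotated A B U V p q X θ ω) ∂ν =
      ∫ ω in (A ∪ B)ᶜ, X ω ∂ν := by
    refine setIntegral_congr_fun (hA.union hB).compl fun ω hω => ?_
    simp only [Set.mem_compl_iff, Set.mem_union, not_or] at hω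
    simp [rotated, hω.1, hω.2, measureReal_def]
  rw [← h1, ← h2, ← h3, add_comm]

end Exchange

/-- The signed measures whose integral functional is dominated by `φ` on `D` and which agree with
`φ` at the constant `c`. -/
def lowerSupports {Ω : Type*} [MeasurableSpace Ω] (D : Set (Ω → ℝ)) (φ : (Ω → ℝ) → ℝ) (c : ℝ) :
    Set (SignedMeasure Ω) :=
  {μ | (∀ X ∈ D, signedIntegral μ X ≤ φ X) ∧ c * μ Set.univ = φ (fun _ : Ω => c)}

/-- `D` consists of bounded random variables, and both `D` and `φ` depend only on the law
under `P`. -/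
structure IsLawInvariant {Ω : Type*} [MeasurableSpace Ω] (P : Measure Ω) (D : Set (Ω → ℝ))
    (φ : (Ω → ℝ) → ℝ) : Prop where
  measurable : ∀ X ∈ D, Measurable X
  bounded : ∀ X ∈ D, ∃ C : ℝ, ∀ ω, |X ω| ≤ C
  mem_of_map_eq : ∀ X ∈ D, ∀ Y : Ω → ℝ, Measurable Y → (∃ C : ℝ, ∀ ω, |Y ω| ≤ C) →
    P.map X = P.map Y → Y ∈ D
  apply_eq : ∀ X ∈ D, ∀ Y ∈ D, P.map X = P.map Y → φ X = φ Y

section Supports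

variable {Ω : Type*} [MeasurableSpace Ω] {P : Measure Ω} {D : Set (Ω → ℝ)} {φ : (Ω → ℝ) → ℝ}
  {c : ℝ} {μ : SignedMeasure Ω} {A B : Set Ω}

theorem IsLawInvariant.signedIntegral_le (h : IsLawInvariant P D φ) (hμ : μ ∈ lowerSupports D φ c)
    {X Y : Ω → ℝ} (hX : X ∈ D) (hY : Measurable Y) {C : ℝ} (hC : ∀ ω, |Y ω| ≤ C)
    (hXY : P.map X = P.map Y) : signedIntegral μ Y ≤ φ X := by
  have hYD := h.mem_of_map_eq X hX Y hY ⟨C, hC⟩ hXY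
  rw [h.apply_eq X hX Y hYD hXY]
  exact hμ.1 Y hYD

/-- A supporting measure vanishes on null sets. -/
theorem IsLawInvariant.apply_eq_zero (h : IsLawInvariant P D φ) (hD : D.Nonempty)
    (hμ : μ ∈ lowerSupports D φ c) {N : Set Ω} (hN : MeasurableSet N) (hN0 : P N = 0) :
    μ N = 0 := by
  obtain ⟨X, hX⟩ := hD
  obtain ⟨C, hC⟩ := h.bounded X hX
  have hXm := h.measurable X hX
  have key : ∀ t : ℝ, signedIntegral μ X + t * μ N ≤ φ X := by
    intro t
    rw [← signedIntegral_add_indicator μ hXm hC hN]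
    refine h.signedIntegral_le hμ hX (hXm.add (measurable_const.indicator hN)) (C := C + |t|)
      (fun ω => ?_) (Measure.map_congr ?_)
    · refine (abs_add_le _ _).trans (add_le_add (hC ω) ?_)
      by_cases hω : ω ∈ N <;> simp [hω]
    · have : ∀ᵐ ω ∂P, ω ∉ N := measure_eq_zero_iff_ae_notMem.1 hN0
      filter_upwards [this] with ω hω
      simp [hω]
  by_contra h0
  have := key ((φ X - signedIntegral μ X + 1) / μ N)
  rw [div_mul_cancel₀ _ h0] at this
  linarith

/-- Exchanging the masses of two disjoint equally likely sets preserves supporting measures. -/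
theorem IsLawInvariant.exchangeMass_mem [IsProbabilityMeasure P] (hP : HasSmallerParts P)
    (h : IsLawInvariant P D φ) (hμ : μ ∈ lowerSupports D φ c) (hA : MeasurableSet A)
    (hB : MeasurableSet B) (hAB : Disjoint A B) (hPAB : P A = P B) (hA0 : P A ≠ 0) :
    (exchangeMass P A B μ.toJordanDecomposition.posPart).toSignedMeasure -
      (exchangeMass P A B μ.toJordanDecomposition.negPart).toSignedMeasure ∈
        lowerSupports D φ c := by
  have hB0 : P B ≠ 0 := hPAB ▸ hA0
  refine ⟨fun X hX => ?_, ?_⟩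
  · obtain ⟨C, hC⟩ := h.bounded X hX
    have hXm := h.measurable X hX
    obtain ⟨U, hU, hUP⟩ := exists_cond_map_eq_volume hP hA hA0
    obtain ⟨V, hV, hVP⟩ := exists_cond_map_eq_volume hP hB hB0
    obtain ⟨p, hp, hpC, hpX⟩ := exists_bounded_map_addCircle_eq_cond hB0 hXm hC
    obtain ⟨q, hq, hqC, hqX⟩ := exists_bounded_map_addCircle_eq_cond hA0 hXm hC
    have hY := measurable_uncurry_rotated (A := A) (B := B) hA hB hU hV hp hq hXm
    have hint : ∀ ν : Measure Ω, IsFiniteMeasure ν →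
        Integrable (fun θ : UnitAddCircle => ∫ ω, rotated A B U V p q X θ ω ∂ν) volume :=
      fun ν _ => (integrable_of_abs_le ((volume : Measure UnitAddCircle).prod ν) hY
        fun x => abs_rotated_le hpC hqC hC x.1 x.2).integral_prod_left
    have hle : ∀ θ : UnitAddCircle, signedIntegral μ (rotated A B U V p q X θ) ≤ φ X := fun θ =>
      h.signedIntegral_le hμ hX hY.of_uncurry_left (abs_rotated_le hpC hqC hC θ)
        (map_rotated hA hB hAB hPAB hU hV hUP hVP hp hq hXm hpX hqX θ)
    rw [signedIntegral_toSignedMeasure_sub _ _ hXm hC,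
      ← integral_integral_rotated hA hB hAB hU hV hp hq hXm hpC hqC hC hpX hqX,
      ← integral_integral_rotated hA hB hAB hU hV hp hq hXm hpC hqC hC hpX hqX,
      ← integral_sub (hint _ inferInstance) (hint _ inferInstance)]
    refine (integral_mono ((hint _ inferInstance).sub (hint _ inferInstance))
      (integrable_const (φ X)) hle).trans_eq ?_
    simp [measureReal_def]
  · rw [Measure.toSignedMeasure_sub_apply MeasurableSet.univ, measureReal_def, measureReal_def,
      exchangeMass_univ hA hB hAB hA0 hB0, exchangeMass_univ hA hB hAB hA0 hB0, ← hμ.2,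
      signedMeasure_apply_eq_posPart_sub_negPart μ MeasurableSet.univ]
    rfl

/-- An upper bound of the supporting measures dominates each of them even after passing to another
equally likely event. -/
theorem IsLawInvariant.apply_le_upperBound [IsProbabilityMeasure P] (hP : HasSmallerParts P)
    (h : IsLawInvariant P D φ) (hD : D.Nonempty) (hμ : μ ∈ lowerSupports D φ c)
    {s : SignedMeasure Ω} (hs : s ∈ upperBounds (lowerSupports D φ c)) (hA : MeasurableSet A)
    (hB : MeasurableSet B) (hPAB : P A = P B) : μ A ≤ s B := by
  have hdisj : ∀ {A B : Set Ω}, MeasurableSet A → MeasurableSet B → Disjoint A B → P A = P B →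
      μ A ≤ s B := by
    intro A B hA hB hAB hPAB
    by_cases hA0 : P A = 0
    · rw [h.apply_eq_zero hD hμ hA hA0, ← h.apply_eq_zero hD hμ hB (hPAB ▸ hA0)]
      exact VectorMeasure.le_iff.1 (hs hμ) B hB
    · have hle := VectorMeasure.le_iff.1
        (hs (h.exchangeMass_mem hP hμ hA hB hAB hPAB hA0)) B hB
      rwa [Measure.toSignedMeasure_sub_apply hB, measureReal_def, measureReal_def,
        exchangeMass_apply hA hB hAB (hPAB ▸ hA0), exchangeMass_apply hA hB hAB (hPAB ▸ hA0),
        ← measureReal_def, ← measureReal_def,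
        ← signedMeasure_apply_eq_posPart_sub_negPart μ hA] at hle
  have hdiff : P (A \ B) = P (B \ A) := measure_sdiff_symm hA.nullMeasurableSet
    hB.nullMeasurableSet hPAB (measure_ne_top _ _)
  have h1 := hdisj (hA.diff hB) (hB.diff hA) disjoint_sdiff_sdiff hdiff
  have h2 := VectorMeasure.le_iff.1 (hs hμ) (A ∩ B) (hA.inter hB)
  have h3 := VectorMeasure.of_add_of_sdiff (v := μ) (hA.inter hB) hA Set.inter_subset_left
  have h4 := VectorMeasure.of_add_of_sdiff (v := s) (hA.inter hB) hB Set.inter_subset_right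
  rw [Set.sdiff_self_inter] at h3
  rw [Set.inter_comm, Set.sdiff_self_inter, Set.inter_comm] at h4
  linarith

/-- Every average density of a supporting measure is at most every average density of an upper
bound. -/
theorem IsLawInvariant.apply_mul_le [IsProbabilityMeasure P] (hP : HasSmallerParts P)
    (h : IsLawInvariant P D φ) (hD : D.Nonempty) (hμ : μ ∈ lowerSupports D φ c)
    {s : SignedMeasure Ω} (hs : s ∈ upperBounds (lowerSupports D φ c)) (hA : MeasurableSet A)
    (hB : MeasurableSet B) (hB0 : P B ≠ 0) : μ A ≤ s B / P.real B * P.real A := by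
  by_cases hA0 : P A = 0
  · simp [h.apply_eq_zero hD hμ hA hA0, measureReal_def, hA0]
  by_contra! hlt
  have hapos : 0 < P.real A := ENNReal.toReal_pos hA0 (measure_ne_top _ _)
  have hbpos : 0 < P.real B := ENNReal.toReal_pos hB0 (measure_ne_top _ _)
  obtain ⟨k₁, hk₁, hk₁'⟩ := exists_between ((lt_div_iff₀ hapos).2 hlt)
  obtain ⟨k₂, hk₂, hk₂'⟩ := exists_between hk₁'
  rw [div_lt_iff₀ hbpos] at hk₁
  rw [lt_div_iff₀ hapos] at hk₂'
  have hPs : ∀ {E : Set Ω}, MeasurableSet E → P.toSignedMeasure E = P.real E := fun hE =>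
    Measure.toSignedMeasure_apply_measurable hE
  obtain ⟨A₁, hA₁, -, hA₁le, hA₁lt⟩ := SignedMeasure.exists_subset_restrict_nonpos
    (s := k₂ • P.toSignedMeasure - μ) (i := A) (by simpa [hPs hA] using hk₂')
  obtain ⟨B₁, hB₁, -, hB₁le, hB₁lt⟩ := SignedMeasure.exists_subset_restrict_nonpos
    (s := s - k₁ • P.toSignedMeasure) (i := B) (by simpa [hPs hB] using hk₁)
  have hA₁0 : P A₁ ≠ 0 := by
    intro h0
    simp [hPs hA₁, measureReal_def, h0, h.apply_eq_zero hD hμ hA₁ h0] at hA₁lt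
  have hB₁0 : P B₁ ≠ 0 := by
    intro h0
    have hle := VectorMeasure.le_iff.1 (hs hμ) B₁ hB₁
    rw [h.apply_eq_zero hD hμ hB₁ h0] at hle
    simp [hPs hB₁, measureReal_def, h0] at hB₁lt
    linarith
  obtain ⟨A₂, hA₂A, B₂, hB₂B, hA₂, hB₂, hPeq, hA₂0⟩ :=
    hP.exists_equal_parts hA₁ hB₁ hA₁0 hB₁0
  have h1 := VectorMeasure.subset_le_of_restrict_le_restrict _ _ hA₁ hA₁le hA₂A
  have h2 := VectorMeasure.subset_le_of_restrict_le_restrict _ _ hB₁ hB₁le hB₂B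
  have h3 := h.apply_le_upperBound hP hD hμ hs hA₂ hB₂ hPeq
  have hpos : 0 < P.real B₂ := ENNReal.toReal_pos (hPeq ▸ hA₂0) (measure_ne_top _ _)
  have heq : P.real A₂ = P.real B₂ := congrArg ENNReal.toReal hPeq
  simp [hPs hA₂, heq] at h1
  simp [hPs hB₂] at h2
  nlinarith

/-- The least upper bound of the supporting measures is a multiple of the reference measure. -/
theorem IsLawInvariant.isLUB_eq_smul [IsProbabilityMeasure P] (hP : HasSmallerParts P)
    (h : IsLawInvariant P D φ) (hD : D.Nonempty) {s : SignedMeasure Ω}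
    (hs : IsLUB (lowerSupports D φ c) s) : s = s Set.univ • P.toSignedMeasure := by
  have hPs : ∀ {E : Set Ω}, MeasurableSet E → P.toSignedMeasure E = P.real E := fun hE =>
    Measure.toSignedMeasure_apply_measurable hE
  obtain ⟨μ, hμ⟩ : (lowerSupports D φ c).Nonempty := by
    by_contra! hempty
    rw [hempty] at hs
    have := VectorMeasure.le_iff.1 (hs.2 (show s - P.toSignedMeasure ∈ upperBounds ∅ by simp))
      Set.univ MeasurableSet.univ
    simp [hPs MeasurableSet.univ] at this
    linarith
  have key : ∀ {A B : Set Ω}, MeasurableSet A → MeasurableSet B → P B ≠ 0 →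
      s A ≤ s B / P.real B * P.real A := by
    intro A B hA hB hB0
    have hub : (s B / P.real B) • P.toSignedMeasure ∈ upperBounds (lowerSupports D φ c) := by
      intro ν hν
      refine VectorMeasure.le_iff.2 fun E hE => ?_
      simpa [hPs hE] using h.apply_mul_le hP hD hν hs.1 hE hB hB0
    simpa [hPs hA] using VectorMeasure.le_iff.1 (hs.2 hub) A hA
  refine VectorMeasure.ext fun A hA => ?_
  have hle := key hA MeasurableSet.univ (by simp)
  simp only [_root_.smul_apply, smul_eq_mul, hPs hA]
  rw [probReal_univ, div_one] at hle
  refine le_antisymm hle ?_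
  by_cases hA0 : P A = 0
  · have := VectorMeasure.le_iff.1 (hs.1 hμ) A hA
    rw [h.apply_eq_zero hD hμ hA hA0] at this
    simpa [measureReal_def, hA0] using this
  · have := key MeasurableSet.univ hA hA0
    rw [probReal_univ, mul_one] at this
    exact (le_div_iff₀ (ENNReal.toReal_pos hA0 (measure_ne_top _ _))).1 this

end Supports

/-- In the setting of Statement 0, fix a constant `c` whose constant random
variable belongs to `D`, and add the normalisation constraint `c·μ(Ω) = φ(c)` to the lower
and upper supporting sets. If the supremum of `L_c` exists in `ca` (setwise order), it is a
scalar multiple of `P`; likewise, if the infimum of `U_c` exists in `ca`, it is a scalar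
multiple of `P`. -/
theorem stmt1 {Ω : Type*} [MeasurableSpace Ω] (P : Measure Ω) [IsProbabilityMeasure P]
    (hatomless : ∀ A : Set Ω, MeasurableSet A → 0 < P A →
      ∃ B : Set Ω, MeasurableSet B ∧ B ⊆ A ∧ 0 < P B ∧ P B < P A)
    (D : Set (Ω → ℝ)) (hne : D.Nonempty)
    (hDmeas : ∀ X ∈ D, Measurable X) (hDbdd : ∀ X ∈ D, ∃ C : ℝ, ∀ ω, |X ω| ≤ C)
    (hDinv : ∀ X ∈ D, ∀ Y : Ω → ℝ, Measurable Y → (∃ C : ℝ, ∀ ω, |Y ω| ≤ C) →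
      P.map X = P.map Y → Y ∈ D)
    (φ : (Ω → ℝ) → ℝ)
    (hφinv : ∀ X ∈ D, ∀ Y ∈ D, P.map X = P.map Y → φ X = φ Y)
    (c : ℝ) (hc : (fun _ : Ω => c) ∈ D) :
    (∀ s : SignedMeasure Ω,
      IsLUB {μ : SignedMeasure Ω | (∀ X ∈ D, signedIntegral μ X ≤ φ X) ∧
        c * μ Set.univ = φ (fun _ : Ω => c)} s →
        ∃ a : ℝ, s = a • P.toSignedMeasure) ∧
    (∀ s : SignedMeasure Ω,
      IsGLB {μ : SignedMeasure Ω | (∀ X ∈ D, φ X ≤ signedIntegral μ X) ∧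
        c * μ Set.univ = φ (fun _ : Ω => c)} s →
        ∃ b : ℝ, s = b • P.toSignedMeasure) := by
  have h : IsLawInvariant P D φ := ⟨hDmeas, hDbdd, hDinv, hφinv⟩
  refine ⟨fun s hs => ⟨_, h.isLUB_eq_smul hatomless hne hs⟩, fun s hs => ?_⟩
  have h' : IsLawInvariant P D (fun X => -φ X) :=
    ⟨hDmeas, hDbdd, hDinv, fun X hX Y hY hXY => congrArg Neg.neg (hφinv X hX Y hY hXY)⟩
  have hneg : ∀ {μ ν : SignedMeasure Ω}, μ ≤ -ν → ν ≤ -μ := fun hle =>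
    VectorMeasure.le_iff.2 fun E hE => le_neg.1 (VectorMeasure.le_iff.1 hle E hE)
  have hlub : IsLUB (lowerSupports D (fun X => -φ X) c) (-s) := by
    refine ⟨fun μ hμ => ?_, fun t ht => ?_⟩
    · refine hneg (hs.1 ⟨fun X hX => ?_, ?_⟩)
      · rw [signedIntegral_neg]
        exact le_neg.1 (hμ.1 X hX)
      · simpa using congrArg Neg.neg hμ.2
    · have hts : -t ≤ s := by
        refine hs.2 fun μ hμ => ?_
        have : -μ ≤ t := ht ⟨fun X hX => ?_, ?_⟩
        · exact VectorMeasure.le_iff.2 fun E hE => neg_le.1 (VectorMeasure.le_iff.1 this E hE)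
        · rw [signedIntegral_neg]
          exact neg_le_neg (hμ.1 X hX)
        · simpa using hμ.2
      exact VectorMeasure.le_iff.2 fun E hE => neg_le.1 (VectorMeasure.le_iff.1 hts E hE)
  refine ⟨s Set.univ, VectorMeasure.ext fun E hE => ?_⟩
  have heq := congrArg (fun ν : SignedMeasure Ω => ν E) (h'.isLUB_eq_smul hatomless hne hlub)
  simpa [hE] using heq
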